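/- Continuity lower bound: for any two states ρ, ω on n qudits of local dimension d, ‖ρ-ω‖_{W₁} ≥ (S(ω) - S(ρ) - ln(n+1) - 1) / ln(d²n). -/

import Mathlib

open scoped ComplexOrder

/-- The trace norm `‖A‖₁ = Tr √(A†A)` (sum of singular values). -/
noncomputable def traceNorm {m : Type*} [Fintype m] [DecidableEq m] (A : Matrix m m ℂ) : ℝ :=
  ∑ i, Real.sqrt ((Matrix.posSemidef_conjTranspose_mul_self A).1.eigenvalues i)

/-- A quantum state (density matrix): positive semidefinite with unit trace. -/
def IsState {m : Type*} [Fintype m] (ρ : Matrix m m ℂ) : Prop :=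
  ρ.PosSemidef ∧ Matrix.trace ρ = 1

/-- Matrix logarithm via the spectral decomposition (junk value `0` off the
Hermitian matrices; on eigenvalue `0` we use `Real.log 0 = 0`, matching the
convention `0 · log 0 = 0` on the support). -/
noncomputable def Matrix.mlog {m : Type*} [Fintype m] [DecidableEq m]
    (A : Matrix m m ℂ) : Matrix m m ℂ :=
  if hA : A.IsHermitian then
    (hA.eigenvectorUnitary : Matrix m m ℂ) *
      Matrix.diagonal (fun i => (Real.log (hA.eigenvalues i) : ℂ)) *
      (star (hA.eigenvectorUnitary : Matrix m m ℂ))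
  else 0

/-- Umegaki's relative entropy `S(ρ‖ω) = Tr[ρ (ln ρ - ln ω)]`. -/
noncomputable def relEnt {m : Type*} [Fintype m] [DecidableEq m] (ρ ω : Matrix m m ℂ) : ℝ :=
  (Matrix.trace (ρ * (ρ.mlog - ω.mlog))).re

/-- Von Neumann entropy `S(ρ) = -Tr[ρ ln ρ]`. -/
noncomputable def vnEnt {m : Type*} [Fintype m] [DecidableEq m] (ρ : Matrix m m ℂ) : ℝ :=
  -(Matrix.trace (ρ * ρ.mlog)).re

/-- Extend a configuration on `V \ {v}` by the value `k` at site `v`. -/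
def insertAt {V : Type*} [DecidableEq V] {d : ℕ} (v : V) (k : Fin d)
    (s : {w : V // w ≠ v} → Fin d) : V → Fin d :=
  fun w => if h : w = v then k else s ⟨w, h⟩

/-- Partial trace over the site `v` of an operator on `n` qudits. -/
noncomputable def ptraceSite {V : Type*} [Fintype V] [DecidableEq V] {d : ℕ} (v : V)
    (X : Matrix (V → Fin d) (V → Fin d) ℂ) :
    Matrix ({w : V // w ≠ v} → Fin d) ({w : V // w ≠ v} → Fin d) ℂ :=
  Matrix.of fun s t => ∑ k : Fin d, X (insertAt v k s) (insertAt v k t)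

/-- Extend a configuration on `V \ A` by a configuration `f` on `A`. -/
def insertSet {V : Type*} [DecidableEq V] {d : ℕ} (A : Finset V)
    (f : {w : V // w ∈ A} → Fin d) (s : {w : V // w ∉ A} → Fin d) : V → Fin d :=
  fun w => if h : w ∈ A then f ⟨w, h⟩ else s ⟨w, h⟩

/-- Partial trace over the sites in `A` of an operator on `n` qudits. -/
noncomputable def ptraceSet {V : Type*} [Fintype V] [DecidableEq V] {d : ℕ} (A : Finset V)
    (X : Matrix (V → Fin d) (V → Fin d) ℂ) :
    Matrix ({w : V // w ∉ A} → Fin d) ({w : V // w ∉ A} → Fin d) ℂ :=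
  Matrix.of fun s t =>
    ∑ f : {w : V // w ∈ A} → Fin d, X (insertSet A f s) (insertSet A f t)

/-- The quantum Wasserstein norm of order 1 of De Palma et al.:
`‖X‖_{W₁} = min { (1/2) ∑_v ‖Y_v‖₁ : X = ∑_v Y_v, Tr_v Y_v = 0 }`. -/
noncomputable def W1norm {V : Type*} [Fintype V] [DecidableEq V] {d : ℕ}
    (X : Matrix (V → Fin d) (V → Fin d) ℂ) : ℝ :=
  sInf { r : ℝ | ∃ Y : V → Matrix (V → Fin d) (V → Fin d) ℂ,
    X = ∑ v, Y v ∧ (∀ v, ptraceSite v (Y v) = 0) ∧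
      r = (1 / 2) * ∑ v, traceNorm (Y v) }

namespace W1aux
open Matrix Real
set_option linter.unusedSectionVars false

section general
variable {m : Type*} [Fintype m] [DecidableEq m]

theorem vnEnt_eq {A : Matrix m m ℂ} (hA : A.IsHermitian) :
    vnEnt A = ∑ i, negMulLog (hA.eigenvalues i) := by
  have h1 : A * A.mlog = (hA.eigenvectorUnitary : Matrix m m ℂ) *
      (diagonal (fun i => (hA.eigenvalues i : ℂ)) *
      diagonal (fun i => (Real.log (hA.eigenvalues i) : ℂ))) *
      star (hA.eigenvectorUnitary : Matrix m m ℂ) := by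
    unfold Matrix.mlog
    rw [dif_pos hA]
    have := hA.spectral_theorem
    rw [Unitary.conjStarAlgAut_apply] at this
    conv_lhs => enter [1]; rw [this]
    have h2 : star (hA.eigenvectorUnitary : Matrix m m ℂ) * (hA.eigenvectorUnitary : Matrix m m ℂ) = 1 :=
      Unitary.coe_star_mul_self _
    simp only [Matrix.mul_assoc]
    rw [← Matrix.mul_assoc (star (hA.eigenvectorUnitary : Matrix m m ℂ)) (hA.eigenvectorUnitary : Matrix m m ℂ), h2, Matrix.one_mul]
    rfl
  unfold vnEnt
  rw [h1, Matrix.trace_mul_comm, ← Matrix.mul_assoc, Unitary.coe_star_mul_self, Matrix.one_mul,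
    diagonal_mul_diagonal, trace_diagonal, Complex.re_sum, ← Finset.sum_neg_distrib]
  refine Finset.sum_congr rfl fun i _ => ?_
  rw [← Complex.ofReal_mul, Complex.ofReal_re, negMulLog]
  ring

theorem exists_diag {A : Matrix m m ℂ} (hA : A.IsHermitian) :
    ∃ (V : Matrix m m ℂ) (l : m → ℝ), Vᴴ * V = 1 ∧ V * Vᴴ = 1 ∧
      A = V * diagonal (fun i => (l i : ℂ)) * Vᴴ ∧ vnEnt A = ∑ i, negMulLog (l i) ∧
      (A.PosSemidef → ∀ i, 0 ≤ l i) := by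
  refine ⟨hA.eigenvectorUnitary, hA.eigenvalues, Unitary.coe_star_mul_self _,
    Unitary.coe_mul_star_self _, ?_, vnEnt_eq hA, fun h => h.eigenvalues_nonneg⟩
  have := hA.spectral_theorem
  rwa [Unitary.conjStarAlgAut_apply] at this

theorem diag_entry (Q : Matrix m m ℂ) (l : m → ℝ) (k : m) :
    ((Qᴴ * diagonal (fun i => (l i : ℂ)) * Q) k k).re = ∑ j, Complex.normSq (Q j k) * l j := by
  rw [Matrix.mul_apply, Complex.re_sum]
  refine Finset.sum_congr rfl fun j _ => ?_
  rw [mul_diagonal, conjTranspose_apply, Complex.normSq_apply]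
  simp
  ring

theorem normSq_sum {Q : Matrix m m ℂ} (h : Qᴴ * Q = 1) (k : m) :
    ∑ j, Complex.normSq (Q j k) = 1 := by
  have := diag_entry Q (fun _ => 1) k
  simp at this
  rw [← this, h]; simp

theorem normSq_sum' {Q : Matrix m m ℂ} (h : Q * Qᴴ = 1) (j : m) :
    ∑ k, Complex.normSq (Q j k) = 1 := by
  have := normSq_sum (Q := Qᴴ) (by simpa using h) j
  simpa [conjTranspose_apply] using this

theorem peierls {A : Matrix m m ℂ} (hA : A.PosSemidef) {U : Matrix m m ℂ}
    (h1 : Uᴴ * U = 1) (h2 : U * Uᴴ = 1) :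
    vnEnt A ≤ ∑ k, negMulLog ((Uᴴ * A * U) k k).re := by
  obtain ⟨V, l, v1, v2, hA', hE, hl⟩ := exists_diag hA.1
  have hl := hl hA
  have e : Uᴴ * A * U = (Vᴴ * U)ᴴ * diagonal (fun i => (l i : ℂ)) * (Vᴴ * U) := by
    rw [hA']; simp [Matrix.mul_assoc]
  have q1 : (Vᴴ * U)ᴴ * (Vᴴ * U) = 1 := by
    rw [conjTranspose_mul, conjTranspose_conjTranspose, Matrix.mul_assoc, ← Matrix.mul_assoc V,
      v2, Matrix.one_mul, h1]
  have q2 : (Vᴴ * U) * (Vᴴ * U)ᴴ = 1 := by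
    rw [conjTranspose_mul, conjTranspose_conjTranspose, Matrix.mul_assoc, ← Matrix.mul_assoc U,
      h2, Matrix.one_mul, v1]
  rw [e, hE]
  simp_rw [diag_entry]
  calc ∑ i, negMulLog (l i) = ∑ i, ∑ k, Complex.normSq ((Vᴴ * U) i k) * negMulLog (l i) := by
        refine Finset.sum_congr rfl fun i _ => ?_
        rw [← Finset.sum_mul, normSq_sum' q2, one_mul]
    _ = ∑ k, ∑ i, Complex.normSq ((Vᴴ * U) i k) * negMulLog (l i) := Finset.sum_comm
    _ ≤ _ := by
        refine Finset.sum_le_sum fun k _ => ?_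
        have := concaveOn_negMulLog.le_map_sum (t := Finset.univ)
          (w := fun i => Complex.normSq ((Vᴴ * U) i k)) (p := l)
          (fun i _ => Complex.normSq_nonneg _) (normSq_sum q1 k) (fun i _ => hl i)
        simpa using this

theorem peierls_eq {A : Matrix m m ℂ} (hA : A.PosSemidef) :
    ∃ U : Matrix m m ℂ, Uᴴ * U = 1 ∧ U * Uᴴ = 1 ∧
      vnEnt A = ∑ k, negMulLog ((Uᴴ * A * U) k k).re := by
  obtain ⟨V, l, v1, v2, hA', hE, hl⟩ := exists_diag hA.1
  refine ⟨V, v1, v2, ?_⟩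
  have : Vᴴ * A * V = diagonal (fun i => (l i : ℂ)) := by
    rw [hA']
    simp only [Matrix.mul_assoc]
    rw [v1, Matrix.mul_one, ← Matrix.mul_assoc, v1, Matrix.one_mul]
  rw [this, hE]
  simp

theorem vnEnt_conj_le {A : Matrix m m ℂ} (hA : A.PosSemidef) {U : Matrix m m ℂ}
    (h1 : Uᴴ * U = 1) (h2 : U * Uᴴ = 1) : vnEnt (U * A * Uᴴ) ≤ vnEnt A := by
  obtain ⟨V, v1, v2, hE⟩ := peierls_eq hA
  have := peierls (hA.mul_mul_conjTranspose_same U) (U := U * V)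
    (by rw [conjTranspose_mul, Matrix.mul_assoc, ← Matrix.mul_assoc Uᴴ, h1, Matrix.one_mul, v1])
    (by rw [conjTranspose_mul, Matrix.mul_assoc, ← Matrix.mul_assoc V, v2, Matrix.one_mul, h2])
  refine this.trans (le_of_eq ?_)
  rw [hE]
  have e : (U * V)ᴴ * (U * A * Uᴴ) * (U * V) = Vᴴ * A * V := by
    rw [conjTranspose_mul]
    simp only [Matrix.mul_assoc]
    rw [← Matrix.mul_assoc Uᴴ U, h1, Matrix.one_mul, ← Matrix.mul_assoc Uᴴ U, h1, Matrix.one_mul]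
  rw [e]

theorem vnEnt_conj {A : Matrix m m ℂ} (hA : A.PosSemidef) {U : Matrix m m ℂ}
    (h1 : Uᴴ * U = 1) (h2 : U * Uᴴ = 1) : vnEnt (U * A * Uᴴ) = vnEnt A := by
  refine le_antisymm (vnEnt_conj_le hA h1 h2) ?_
  have := vnEnt_conj_le (hA.mul_mul_conjTranspose_same U) (U := Uᴴ) (by simpa using h2)
    (by simpa using h1)
  refine le_trans (le_of_eq ?_) this
  congr 1
  rw [conjTranspose_conjTranspose]
  simp only [Matrix.mul_assoc]
  rw [h1, Matrix.mul_one, ← Matrix.mul_assoc, h1, Matrix.one_mul]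

theorem vnEnt_roots {A : Matrix m m ℂ} (hA : A.IsHermitian) :
    vnEnt A = (A.charpoly.roots.map (fun z => negMulLog z.re)).sum := by
  rw [vnEnt_eq hA, hA.roots_charpoly_eq_eigenvalues, Multiset.map_map]
  simp

theorem vnEnt_gram {n : Type*} [Fintype n] [DecidableEq n] (W : Matrix m n ℂ) :
    vnEnt (W * Wᴴ) = vnEnt (Wᴴ * W) := by
  rw [vnEnt_roots (isHermitian_mul_conjTranspose_self W),
    vnEnt_roots (isHermitian_conjTranspose_mul_self W)]
  have h := charpoly_mul_comm' W Wᴴ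
  have h := congrArg (fun p => (p.roots.map (fun z : ℂ => negMulLog z.re)).sum) h
  rw [Polynomial.roots_mul, Polynomial.roots_mul] at h
  · simpa [Multiset.map_nsmul, Multiset.sum_nsmul] using h
  · exact mul_ne_zero (pow_ne_zero _ Polynomial.X_ne_zero) (charpoly_monic _).ne_zero
  · exact mul_ne_zero (pow_ne_zero _ Polynomial.X_ne_zero) (charpoly_monic _).ne_zero

theorem vnEnt_sum_le {ι : Type*} [Fintype ι] [DecidableEq ι] (A : ι → Matrix m m ℂ)
    (hA : ∀ i, (A i).PosSemidef) : vnEnt (∑ i, A i) ≤ ∑ i, vnEnt (A i) := by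
  choose V l v1 v2 hA' hE hl using fun i => exists_diag (hA i).1
  have hl := fun i => hl i (hA i)
  let W : Matrix m (ι × m) ℂ := Matrix.of fun a p => V p.1 a p.2 * (Real.sqrt (l p.1 p.2) : ℂ)
  have hsq : ∀ i b, (Real.sqrt (l i b) : ℂ) * (Real.sqrt (l i b) : ℂ) = (l i b : ℂ) := by
    intro i b
    rw [← Complex.ofReal_mul, Real.mul_self_sqrt (hl i b)]
  have e1 : ∑ i, A i = W * Wᴴ := by
    ext a b
    rw [Matrix.sum_apply, Matrix.mul_apply, Fintype.sum_prod_type]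
    refine Finset.sum_congr rfl fun i _ => ?_
    rw [hA' i, Matrix.mul_apply]
    refine Finset.sum_congr rfl fun j _ => ?_
    rw [mul_diagonal, conjTranspose_apply, conjTranspose_apply]
    simp only [W, Matrix.of_apply, star_mul', ← hsq]
    simp
    ring
  have e2 : ∀ i b, ((Wᴴ * W) (i, b) (i, b)).re = l i b := by
    intro i b
    rw [Matrix.mul_apply]
    have : ∀ x, Wᴴ (i, b) x * W x (i, b) = ((V i)ᴴ b x * V i x b) * (l i b : ℂ) := by
      intro x
      rw [conjTranspose_apply, conjTranspose_apply]
      simp only [W, Matrix.of_apply, star_mul', ← hsq]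
      simp
      ring
    simp_rw [this]
    rw [← Finset.sum_mul, ← Matrix.mul_apply, v1]
    simp
  rw [e1, vnEnt_gram]
  have := peierls (posSemidef_conjTranspose_mul_self W) (U := 1) (by simp) (by simp)
  refine this.trans (le_of_eq ?_)
  simp only [conjTranspose_one, Matrix.one_mul, Matrix.mul_one, hE]
  rw [Fintype.sum_prod_type]
  simp_rw [e2]

/-- homogeneous entropy -/
noncomputable def F (A : Matrix m m ℂ) : ℝ := vnEnt A - negMulLog (A.trace).re

theorem logsum {a b α β : ℝ} (ha : 0 ≤ a) (hb : 0 ≤ b) (haα : a ≤ α) (hbβ : b ≤ β) :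
    (negMulLog a + a * log α) + (negMulLog b + b * log β) ≤
      negMulLog (a + b) + (a + b) * log (α + β) := by
  rcases eq_or_lt_of_le ha with rfl | ha
  · rcases eq_or_lt_of_le hb with rfl | hb
    · simp
    · have : log β ≤ log (α + β) := log_le_log (by linarith) (by linarith)
      simp
      nlinarith
  rcases eq_or_lt_of_le hb with rfl | hb
  · have : log α ≤ log (α + β) := log_le_log (by linarith) (by linarith)
    simp
    nlinarith
  have hα : 0 < α := by linarith
  have hβ : 0 < β := by linarith
  -- a log(α/a) + b log (β/b) ≤ (a+b) log ((α+β)/(a+b))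
  have h1 : log ((α / a) * ((a + b) / (α + β))) ≤ (α / a) * ((a + b) / (α + β)) - 1 :=
    log_le_sub_one_of_pos (by positivity)
  have h2 : log ((β / b) * ((a + b) / (α + β))) ≤ (β / b) * ((a + b) / (α + β)) - 1 :=
    log_le_sub_one_of_pos (by positivity)
  have h3 : a * ((α / a) * ((a + b) / (α + β)) - 1) + b * ((β / b) * ((a + b) / (α + β)) - 1) = 0 := by
    field_simp
    ring
  rw [log_mul (by positivity) (by positivity), log_div (by positivity) (by positivity),
    log_div (by positivity) (by positivity)] at h1 h2
  have h4 := mul_le_mul_of_nonneg_left h1 ha.le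
  have h5 := mul_le_mul_of_nonneg_left h2 hb.le
  simp only [negMulLog]
  nlinarith

theorem diag_nonneg {A : Matrix m m ℂ} (hA : A.PosSemidef) (U : Matrix m m ℂ) (k : m) :
    0 ≤ ((Uᴴ * A * U) k k).re := by
  have := (hA.conjTranspose_mul_mul_same U).diag_nonneg (i := k)
  exact (Complex.le_def.1 this).1

theorem trace_conj (A : Matrix m m ℂ) {U : Matrix m m ℂ} (h2 : U * Uᴴ = 1) :
    ∑ k, ((Uᴴ * A * U) k k).re = (A.trace).re := by
  rw [← Complex.re_sum]
  change (trace (Uᴴ * A * U)).re = _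
  rw [Matrix.trace_mul_comm, ← Matrix.mul_assoc, h2, Matrix.one_mul]

theorem F_add {A B : Matrix m m ℂ} (hA : A.PosSemidef) (hB : B.PosSemidef) :
    F A + F B ≤ F (A + B) := by
  obtain ⟨U, u1, u2, hE⟩ := peierls_eq (hA.add hB)
  have pA := peierls hA u1 u2
  have pB := peierls hB u1 u2
  have tA := trace_conj A u2
  have tB := trace_conj B u2
  unfold F
  rw [hE]
  set a := fun k => ((Uᴴ * A * U) k k).re
  set b := fun k => ((Uᴴ * B * U) k k).re
  have hab : ∀ k, ((Uᴴ * (A + B) * U) k k).re = a k + b k := by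
    intro k; simp [a, b, Matrix.mul_add, Matrix.add_mul]
  have ha : ∀ k, 0 ≤ a k := diag_nonneg hA U
  have hb : ∀ k, 0 ≤ b k := diag_nonneg hB U
  simp_rw [hab]
  rw [trace_add, Complex.add_re, ← tA, ← tB]
  have key := Finset.sum_le_sum fun k (_ : k ∈ Finset.univ) =>
    logsum (ha k) (hb k) (Finset.single_le_sum (fun i _ => ha i) (Finset.mem_univ k))
      (Finset.single_le_sum (fun i _ => hb i) (Finset.mem_univ k))
  simp only [Finset.sum_add_distrib, ← Finset.sum_mul] at key
  change vnEnt A ≤ ∑ k, negMulLog (a k) at pA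
  change vnEnt B ≤ ∑ k, negMulLog (b k) at pB
  have n1 : ∀ x, negMulLog x = - (x * log x) := fun x => by rw [negMulLog]; ring
  change vnEnt A - negMulLog (∑ k, a k) + (vnEnt B - negMulLog (∑ k, b k)) ≤ _ -
    negMulLog (∑ k, a k + ∑ k, b k)
  rw [n1 (∑ k, a k), n1 (∑ k, b k), n1 (∑ k, a k + ∑ k, b k)]
  linarith

theorem F_zero : F (0 : Matrix m m ℂ) = 0 := by
  simp [F, vnEnt]

theorem F_sum {ι : Type*} (s : Finset ι) (A : ι → Matrix m m ℂ)
    (hA : ∀ i, (A i).PosSemidef) : ∑ i ∈ s, F (A i) ≤ F (∑ i ∈ s, A i) := by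
  classical
  induction s using Finset.induction_on with
  | empty => simp [F_zero]
  | insert i s hi ih =>
    rw [Finset.sum_insert hi, Finset.sum_insert hi]
    have := F_add (hA i) (posSemidef_sum s fun j _ => hA j)
    linarith

/-- Jordan decomposition with trace-norm control. -/
theorem jordan (Y : Matrix m m ℂ) (hT : Y.trace = 0) :
    ∃ P N : Matrix m m ℂ, P.PosSemidef ∧ N.PosSemidef ∧ P - N = (1 / 2 : ℂ) • (Y + Yᴴ) ∧
      P.trace = N.trace ∧ P.trace.re ≤ (1 / 2) * traceNorm Y := by
  have hH : ((1 / 2 : ℂ) • (Y + Yᴴ)).IsHermitian := by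
    rw [IsHermitian, conjTranspose_smul, conjTranspose_add, conjTranspose_conjTranspose, add_comm]
    simp
  obtain ⟨U, h, u1, u2, hE, -, -⟩ := exists_diag hH
  set H := (1 / 2 : ℂ) • (Y + Yᴴ) with hHdef
  have tr : ∀ f : m → ℂ, (U * diagonal f * Uᴴ).trace = ∑ i, f i := by
    intro f
    rw [trace_mul_comm, ← Matrix.mul_assoc, u1, Matrix.one_mul, trace_diagonal]
  have psd : ∀ f : m → ℝ, (∀ i, 0 ≤ f i) → (U * diagonal (fun i => (f i : ℂ)) * Uᴴ).PosSemidef := by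
    intro f hf
    apply PosSemidef.mul_mul_conjTranspose_same
    apply PosSemidef.diagonal
    intro i
    simpa using hf i
  have hHt : H.trace = 0 := by
    rw [hHdef, trace_smul, trace_add, trace_conjTranspose, hT]; simp
  have hPN : U * diagonal (fun i => ((max (h i) 0 : ℝ) : ℂ)) * Uᴴ -
      U * diagonal (fun i => ((max (-h i) 0 : ℝ) : ℂ)) * Uᴴ = H := by
    rw [hE, ← Matrix.sub_mul, ← Matrix.mul_sub, diagonal_sub]
    congr! 4 with i
    rw [← Complex.ofReal_sub]
    congr 1
    rcases le_total (h i) 0 with h' | h'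
    · rw [max_eq_right h', max_eq_left (by linarith)]; ring
    · rw [max_eq_left h', max_eq_right (by linarith)]; ring
  have htr : (U * diagonal (fun i => ((max (h i) 0 : ℝ) : ℂ)) * Uᴴ).trace =
      (U * diagonal (fun i => ((max (-h i) 0 : ℝ) : ℂ)) * Uᴴ).trace := by
    rw [← sub_eq_zero, ← trace_sub, hPN, hHt]
  refine ⟨_, _, psd _ fun i => le_max_right _ _, psd _ fun i => le_max_right _ _, hPN, htr, ?_⟩
  -- trace norm bound
  have hs : ∀ i, ∃ s : ℝ, s * s = 1 ∧ s * h i = |h i| := by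
    intro i
    rcases le_total (h i) 0 with h' | h'
    · exact ⟨-1, by norm_num, by rw [abs_of_nonpos h']; ring⟩
    · exact ⟨1, by norm_num, by rw [abs_of_nonneg h']; ring⟩
  choose s hs1 hs2 using hs
  set Z := U * diagonal (fun i => (s i : ℂ)) * Uᴴ with hZ
  have Zh : Zᴴ = Z := by
    rw [hZ]
    simp only [conjTranspose_mul, conjTranspose_conjTranspose, diagonal_conjTranspose,
      Matrix.mul_assoc]
    congr! 3
    ext i; simp
  have diagm : ∀ f g : m → ℂ, (U * diagonal f * Uᴴ) * (U * diagonal g * Uᴴ) =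
      U * diagonal (fun i => f i * g i) * Uᴴ := by
    intro f g
    rw [← diagonal_mul_diagonal]
    simp only [Matrix.mul_assoc]
    rw [← Matrix.mul_assoc Uᴴ U, u1, Matrix.one_mul]
  have ZZ : Z * Z = 1 := by
    rw [hZ, diagm]
    have : (fun i => (s i : ℂ) * (s i : ℂ)) = fun _ => 1 := by
      ext i; rw [← Complex.ofReal_mul, hs1]; simp
    rw [this, diagonal_one, Matrix.mul_one, u2]
  have e1 : ((Z * Y).trace).re = ∑ i, |h i| := by
    have a1 : (Z * H).trace = ∑ i, ((|h i| : ℝ) : ℂ) := by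
      rw [hE, hZ, diagm, tr]
      simp [← hs2]
    have a2 : (Z * Yᴴ).trace = star (Z * Y).trace := by
      rw [← trace_conjTranspose, conjTranspose_mul, Zh, trace_mul_comm]
    rw [hHdef, Matrix.mul_smul, Matrix.mul_add, trace_smul, trace_add, a2] at a1
    have a3 := congrArg Complex.re a1
    simp only [Complex.re_sum, Complex.ofReal_re] at a3
    rw [← a3]
    simp
    ring
  have e2 : ((Z * Y).trace).re ≤ traceNorm Y := by
    unfold traceNorm
    set hY := (Matrix.posSemidef_conjTranspose_mul_self Y).1
    obtain ⟨V, v1, v2, sp⟩ : ∃ V : Matrix m m ℂ, Vᴴ * V = 1 ∧ V * Vᴴ = 1 ∧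
        Yᴴ * Y = V * diagonal (fun i => (hY.eigenvalues i : ℂ)) * Vᴴ := by
      refine ⟨hY.eigenvectorUnitary, Unitary.coe_star_mul_self _, Unitary.coe_mul_star_self _, ?_⟩
      have := hY.spectral_theorem
      rwa [Unitary.conjStarAlgAut_apply] at this
    generalize hY.eigenvalues = ev at sp ⊢
    have t1 : (Z * Y).trace = ∑ i, (Vᴴ * (Z * Y) * V) i i := by
      change _ = trace _
      rw [trace_mul_comm (Vᴴ * (Z * Y)) V, ← Matrix.mul_assoc, v2, Matrix.one_mul]
    rw [t1, Complex.re_sum]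
    refine Finset.sum_le_sum fun i _ => ?_
    have t2 : Vᴴ * (Z * Y) * V = (Z * V)ᴴ * (Y * V) := by
      rw [conjTranspose_mul, Zh]; simp only [Matrix.mul_assoc]
    have nrm : ∀ B : Matrix m m ℂ, ((Bᴴ * B) i i).re = ∑ a, ‖B a i‖ ^ 2 := by
      intro B
      rw [Matrix.mul_apply, Complex.re_sum]
      refine Finset.sum_congr rfl fun a _ => ?_
      rw [conjTranspose_apply, ← Complex.normSq_eq_norm_sq, Complex.normSq_apply]
      simp
    have n1 : ∑ a, ‖(Z * V) a i‖ ^ 2 = 1 := by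
      rw [← nrm, conjTranspose_mul, Zh, Matrix.mul_assoc, ← Matrix.mul_assoc Z, ZZ,
        Matrix.one_mul, v1]
      simp
    have n2 : ∑ a, ‖(Y * V) a i‖ ^ 2 = ev i := by
      rw [← nrm, conjTranspose_mul, Matrix.mul_assoc, ← Matrix.mul_assoc Yᴴ, sp]
      simp only [Matrix.mul_assoc]
      rw [v1, Matrix.mul_one, ← Matrix.mul_assoc, v1]
      simp
    rw [t2, Matrix.mul_apply]
    calc (∑ a, (Z * V)ᴴ i a * (Y * V) a i).re ≤ ‖∑ a, (Z * V)ᴴ i a * (Y * V) a i‖ :=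
          Complex.re_le_norm _
      _ ≤ ∑ a, ‖(Z * V)ᴴ i a * (Y * V) a i‖ := norm_sum_le _ _
      _ = ∑ a, ‖(Z * V) a i‖ * ‖(Y * V) a i‖ := by
          simp [-conjTranspose_mul, conjTranspose_apply]
      _ ≤ √(∑ a, ‖(Z * V) a i‖ ^ 2) * √(∑ a, ‖(Y * V) a i‖ ^ 2) :=
          Real.sum_mul_le_sqrt_mul_sqrt _ _ _
      _ = _ := by rw [n1, n2]; simp
  have e3 : (∑ i, h i) = 0 := by
    have := tr (fun i => (h i : ℂ))
    rw [← hE, hHt, ← Complex.ofReal_sum] at this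
    exact_mod_cast this.symm
  rw [tr, Complex.re_sum]
  simp only [Complex.ofReal_re]
  have e4 : ∀ i, max (h i) 0 = (1 / 2) * |h i| + (1 / 2) * h i := by
    intro i
    rcases le_total (h i) 0 with h' | h'
    · rw [max_eq_right h', abs_of_nonpos h']; ring
    · rw [max_eq_left h', abs_of_nonneg h']; ring
  simp_rw [e4]
  rw [Finset.sum_add_distrib, ← Finset.mul_sum, ← Finset.mul_sum, e3]
  linarith

end general

theorem sum_negMulLog_le {ι : Type*} [Fintype ι] [Nonempty ι] (c : ι → ℝ) (hc : ∀ i, 0 ≤ c i) :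
    ∑ i, negMulLog (c i) ≤ negMulLog (∑ i, c i) + (∑ i, c i) * log (Fintype.card ι) := by
  have hN : (0 : ℝ) < Fintype.card ι := by exact_mod_cast Fintype.card_pos
  set N : ℝ := (Fintype.card ι : ℝ) with hNdef
  have := concaveOn_negMulLog.le_map_sum (t := Finset.univ)
    (w := fun _ : ι => N⁻¹) (p := c) (fun i _ => by positivity)
    (by simp [hNdef]) (fun i _ => hc i)
  simp only [smul_eq_mul, ← Finset.mul_sum] at this
  rw [negMulLog_mul] at this
  have h2 : negMulLog N⁻¹ = N⁻¹ * log N := by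
    rw [negMulLog, log_inv]; ring
  rw [h2] at this
  have h3 := mul_le_mul_of_nonneg_left this hN.le
  field_simp at h3
  linarith

section bounds
variable {m : Type*} [Fintype m] [DecidableEq m]

theorem vnEnt_le_log {A : Matrix m m ℂ} (hA : IsState A) :
    vnEnt A ≤ log (Fintype.card m) := by
  have ht : ∑ i, hA.1.1.eigenvalues i = 1 := by
    have := hA.1.1.trace_eq_sum_eigenvalues
    have h' := this.symm.trans hA.2
    have h2 := congrArg Complex.re h'
    rw [Complex.re_sum] at h2
    simpa using h2
  have : Nonempty m := by
    by_contra h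
    rw [not_nonempty_iff] at h
    simp at ht
  rw [vnEnt_eq hA.1.1]
  refine (sum_negMulLog_le _ hA.1.eigenvalues_nonneg).trans ?_
  rw [ht]; simp

theorem vnEnt_nonneg {A : Matrix m m ℂ} (hA : IsState A) : 0 ≤ vnEnt A := by
  have ht : ∑ i, hA.1.1.eigenvalues i = 1 := by
    have := hA.1.1.trace_eq_sum_eigenvalues
    have h' := this.symm.trans hA.2
    have h2 := congrArg Complex.re h'
    rw [Complex.re_sum] at h2
    simpa using h2
  rw [vnEnt_eq hA.1.1]
  refine Finset.sum_nonneg fun i _ => negMulLog_nonneg (hA.1.eigenvalues_nonneg i) ?_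
  rw [← ht]
  exact Finset.single_le_sum (fun i _ => hA.1.eigenvalues_nonneg i) (Finset.mem_univ i)

theorem F_conj {A : Matrix m m ℂ} (hA : A.PosSemidef) {U : Matrix m m ℂ}
    (h1 : Uᴴ * U = 1) (h2 : U * Uᴴ = 1) : F (U * A * Uᴴ) = F A := by
  rw [F, F, vnEnt_conj hA h1 h2, trace_mul_comm, ← Matrix.mul_assoc, h1, Matrix.one_mul]

end bounds

section twirl
variable {V : Type*} [Fintype V] [DecidableEq V] {d : ℕ} [NeZero d]

/-- root of unity -/
noncomputable def zeta (d : ℕ) : ℂ := Complex.exp (2 * π * Complex.I / d)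

theorem zeta_prim : IsPrimitiveRoot (zeta d) d := Complex.isPrimitiveRoot_exp d (NeZero.ne d)

theorem zeta_mul : zeta d * star (zeta d) = 1 := by
  have := (zeta_prim (d := d)).norm'_eq_one (NeZero.ne d)
  have h := Complex.mul_conj (zeta d)
  rw [Complex.normSq_eq_norm_sq, this] at h
  simpa using h

theorem zeta_orth (k l : Fin d) (h : k ≠ l) :
    ∑ b : Fin d, zeta d ^ ((b : ℕ) * k) * star (zeta d ^ ((b : ℕ) * l)) = 0 := by
  set q := zeta d ^ (k : ℕ) * star (zeta d ^ (l : ℕ)) with hq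
  have h1 : ∀ b : Fin d, zeta d ^ ((b : ℕ) * k) * star (zeta d ^ ((b : ℕ) * l)) = q ^ (b : ℕ) := by
    intro b
    rw [hq, mul_pow, ← star_pow, ← pow_mul, ← pow_mul, mul_comm (b : ℕ), mul_comm (b : ℕ)]
  simp_rw [h1]
  rw [Fin.sum_univ_eq_sum_range (fun i => q ^ i)]
  have hqd : q ^ d = 1 := by
    rw [hq, mul_pow, ← star_pow, ← pow_mul, ← pow_mul, mul_comm (k : ℕ), mul_comm (l : ℕ),
      pow_mul, pow_mul, (zeta_prim (d := d)).pow_eq_one]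
    simp
  have hq1 : q ≠ 1 := by
    intro h2
    apply h
    apply Fin.ext
    apply (zeta_prim (d := d)).pow_inj k.2 l.2
    have h3 : zeta d ^ (l : ℕ) * star (zeta d ^ (l : ℕ)) = 1 := by
      rw [star_pow, ← mul_pow, zeta_mul, one_pow]
    have h4 : star (zeta d ^ (l : ℕ)) ≠ 0 := right_ne_zero_of_mul_eq_one h3
    exact mul_right_cancel₀ h4 (h2.trans h3.symm)
  rw [geom_sum_eq hq1, hqd]
  simp

theorem zeta_orth_self (k : Fin d) :
    ∑ b : Fin d, zeta d ^ ((b : ℕ) * k) * star (zeta d ^ ((b : ℕ) * k)) = d := by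
  simp_rw [star_pow, ← mul_pow, zeta_mul]
  simp

/-- Shift at site v. -/
def shiftE (v : V) (a : Fin d) : (V → Fin d) ≃ (V → Fin d) := Equiv.addRight (Pi.single v a)

/-- clock phases -/
noncomputable def ph (v : V) (b : Fin d) (t : V → Fin d) : ℂ := zeta d ^ ((b : ℕ) * t v)

/-- Weyl unitaries at site v. -/
noncomputable def weyl (v : V) (p : Fin d × Fin d) : Matrix (V → Fin d) (V → Fin d) ℂ :=
  (diagonal (ph v p.2)).submatrix (shiftE v p.1) id

theorem weyl_conj (v : V) (p : Fin d × Fin d) (X : Matrix (V → Fin d) (V → Fin d) ℂ) :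
    weyl v p * X * (weyl v p)ᴴ =
      (diagonal (ph v p.2) * X * (diagonal (ph v p.2))ᴴ).submatrix (shiftE v p.1) (shiftE v p.1) := by
  ext s t
  simp [weyl, Matrix.mul_apply, diagonal_apply]

theorem weyl_mul (v : V) (p : Fin d × Fin d) : weyl v p * (weyl v p)ᴴ = 1 := by
  have := weyl_conj v p 1
  rw [Matrix.mul_one, Matrix.mul_one, diagonal_conjTranspose, diagonal_mul_diagonal] at this
  rw [this]
  have h : (fun i => ph v p.2 i * star (ph v p.2) i) = fun _ => 1 := by
    ext i
    rw [Pi.star_apply, ph, star_pow, ← mul_pow, zeta_mul, one_pow]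
  rw [h, diagonal_one, submatrix_one_equiv]

theorem weyl_mul' (v : V) (p : Fin d × Fin d) : (weyl v p)ᴴ * weyl v p = 1 :=
  mul_eq_one_comm.1 (weyl_mul v p)

theorem insertAt_restrict (v : V) (s : V → Fin d) (a : Fin d) :
    insertAt v (a + s v) (fun w => s w.1) = shiftE v a s := by
  ext w
  unfold insertAt
  by_cases h : w = v
  · subst h; simp [shiftE, add_comm]
  · simp [shiftE, h]

theorem twirl_zero (v : V) (X : Matrix (V → Fin d) (V → Fin d) ℂ) (hX : ptraceSite v X = 0) :
    ∑ p : Fin d × Fin d, weyl v p * X * (weyl v p)ᴴ = 0 := by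
  ext s t
  rw [Matrix.sum_apply, Fintype.sum_prod_type]
  simp only [weyl_conj, submatrix_apply]
  have h1 : ∀ a b : Fin d, (diagonal (ph v b) * X * (diagonal (ph v b))ᴴ) (shiftE v a s) (shiftE v a t)
      = (ph v b (shiftE v a s) * star (ph v b (shiftE v a t))) * X (shiftE v a s) (shiftE v a t) := by
    intro a b
    rw [diagonal_conjTranspose, mul_diagonal, diagonal_mul, Pi.star_apply]
    ring
  simp only [h1, ← Finset.sum_mul, ph]
  by_cases hst : s v = t v
  · have h2 : ∀ a, (shiftE v a t) v = (shiftE v a s) v := by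
      intro a; simp [shiftE, hst]
    simp only [h2, zeta_orth_self, ← Finset.mul_sum]
    have h3 := congrFun (congrFun hX (fun w => s w.1)) (fun w => t w.1)
    simp only [ptraceSite, Matrix.of_apply, Matrix.zero_apply] at h3
    rw [← Equiv.sum_comp (Equiv.addRight (s v))] at h3
    simp only [Equiv.coe_addRight, insertAt_restrict] at h3
    conv at h3 => enter [1, 2, a]; rw [hst, insertAt_restrict]
    rw [h3]; simp
  · refine Finset.sum_eq_zero fun a _ => ?_
    rw [zeta_orth, zero_mul]
    simpa [shiftE] using hst

theorem trace_weyl (v : V) (p : Fin d × Fin d) (X : Matrix (V → Fin d) (V → Fin d) ℂ) :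
    (weyl v p * X * (weyl v p)ᴴ).trace = X.trace := by
  rw [trace_mul_comm, ← Matrix.mul_assoc, weyl_mul', Matrix.one_mul]

theorem trace_twirl (v : V) (X : Matrix (V → Fin d) (V → Fin d) ℂ) :
    (∑ p : Fin d × Fin d, weyl v p * X * (weyl v p)ᴴ).trace = (d : ℂ) ^ 2 * X.trace := by
  rw [trace_sum]
  simp_rw [trace_weyl]
  simp [pow_two]

theorem trace_zero (v : V) (X : Matrix (V → Fin d) (V → Fin d) ℂ) (hX : ptraceSite v X = 0) :
    X.trace = 0 := by
  have := trace_twirl v X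
  rw [twirl_zero v X hX, Matrix.trace_zero] at this
  have hd : (d : ℂ) ≠ 0 := by exact_mod_cast NeZero.ne d
  simpa [hd] using this.symm

theorem F_le (v : V) {P N : Matrix (V → Fin d) (V → Fin d) ℂ} (hP : P.PosSemidef)
    (hN : N.PosSemidef) (h : ptraceSite v (P - N) = 0) :
    F N ≤ F P + 2 * P.trace.re * log d := by
  have h0 := twirl_zero v _ h
  have h0' : ∑ p : Fin d × Fin d, weyl v p * P * (weyl v p)ᴴ =
      ∑ p : Fin d × Fin d, weyl v p * N * (weyl v p)ᴴ := by
    rw [← sub_eq_zero, ← Finset.sum_sub_distrib, ← h0]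
    refine Finset.sum_congr rfl fun p _ => ?_
    rw [Matrix.mul_sub, Matrix.sub_mul]
  have hd : (0 : ℝ) < d := by exact_mod_cast Nat.pos_of_ne_zero (NeZero.ne d)
  have a1 := F_sum Finset.univ (fun p : Fin d × Fin d => weyl v p * N * (weyl v p)ᴴ)
    (fun p => hN.mul_mul_conjTranspose_same _)
  have a2 := vnEnt_sum_le (fun p : Fin d × Fin d => weyl v p * P * (weyl v p)ᴴ)
    (fun p => hP.mul_mul_conjTranspose_same _)
  simp only [F_conj hN (weyl_mul' v _) (weyl_mul v _)] at a1
  simp only [vnEnt_conj hP (weyl_mul' v _) (weyl_mul v _)] at a2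
  rw [← h0', F.eq_1 (∑ p : Fin d × Fin d, weyl v p * P * (weyl v p)ᴴ), trace_twirl] at a1
  have e : ((d : ℂ) ^ 2 * P.trace).re = (d : ℝ) ^ 2 * P.trace.re := by
    rw [← Complex.ofReal_natCast, ← Complex.ofReal_pow, Complex.re_ofReal_mul]
  have e2 : negMulLog ((d : ℝ) ^ 2) = - ((d : ℝ) ^ 2 * (2 * log d)) := by
    rw [negMulLog, log_pow]; push_cast; ring
  rw [e, negMulLog_mul, e2] at a1
  simp only [Finset.sum_const, Finset.card_univ, Fintype.card_prod, Fintype.card_fin, nsmul_eq_mul,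
    Nat.cast_mul] at a1 a2
  have a3 : (d : ℝ) ^ 2 * F N ≤ (d : ℝ) ^ 2 * (vnEnt P - negMulLog P.trace.re + 2 * P.trace.re * log d) := by
    linarith
  exact le_of_mul_le_mul_left a3 (by positivity)

theorem ptrace_herm (v : V) (Y : Matrix (V → Fin d) (V → Fin d) ℂ) (hY : ptraceSite v Y = 0) :
    ptraceSite v ((1 / 2 : ℂ) • (Y + Yᴴ)) = 0 := by
  ext s t
  have h1 := congrFun (congrFun hY s) t
  have h2 := congrArg star (congrFun (congrFun hY t) s)
  simp only [ptraceSite, Matrix.of_apply, Matrix.zero_apply, star_sum, star_zero] at h1 h2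
  simp only [ptraceSite, Matrix.of_apply, Matrix.zero_apply, Matrix.smul_apply, Matrix.add_apply,
    conjTranspose_apply, ← Finset.smul_sum, Finset.sum_add_distrib, h1, h2]
  simp

/-- The existence of a decomposition. -/
def Dec (X : Matrix (V → Fin d) (V → Fin d) ℂ) : Prop :=
  ∃ Y : V → Matrix (V → Fin d) (V → Fin d) ℂ, X = ∑ v, Y v ∧ ∀ v, ptraceSite v (Y v) = 0

theorem ptrace_add (v : V) (X Y : Matrix (V → Fin d) (V → Fin d) ℂ) :
    ptraceSite v (X + Y) = ptraceSite v X + ptraceSite v Y := by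
  ext s t; simp [ptraceSite, Finset.sum_add_distrib]

theorem ptrace_sub (v : V) (X Y : Matrix (V → Fin d) (V → Fin d) ℂ) :
    ptraceSite v (X - Y) = ptraceSite v X - ptraceSite v Y := by
  ext s t; simp [ptraceSite, Finset.sum_sub_distrib]

theorem ptrace_smul (v : V) (c : ℂ) (X : Matrix (V → Fin d) (V → Fin d) ℂ) :
    ptraceSite v (c • X) = c • ptraceSite v X := by
  ext s t; simp [ptraceSite, Finset.mul_sum]

theorem dec_zero : Dec (0 : Matrix (V → Fin d) (V → Fin d) ℂ) :=
  ⟨fun _ => 0, by simp, fun v => by ext s t; simp [ptraceSite]⟩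

theorem dec_add {X Y : Matrix (V → Fin d) (V → Fin d) ℂ} (hX : Dec X) (hY : Dec Y) :
    Dec (X + Y) := by
  obtain ⟨A, rfl, hA⟩ := hX
  obtain ⟨B, rfl, hB⟩ := hY
  exact ⟨fun v => A v + B v, by rw [Finset.sum_add_distrib], fun v => by
    rw [ptrace_add, hA, hB, add_zero]⟩

theorem dec_smul (c : ℂ) {X : Matrix (V → Fin d) (V → Fin d) ℂ} (hX : Dec X) :
    Dec (c • X) := by
  obtain ⟨A, rfl, hA⟩ := hX
  exact ⟨fun v => c • A v, by rw [Finset.smul_sum], fun v => by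
    rw [ptrace_smul, hA, smul_zero]⟩

theorem dec_sum {ι : Type*} (s : Finset ι) (X : ι → Matrix (V → Fin d) (V → Fin d) ℂ)
    (hX : ∀ i, Dec (X i)) : Dec (∑ i ∈ s, X i) := by
  classical
  induction s using Finset.induction_on with
  | empty => simpa using dec_zero
  | insert i s hi ih => rw [Finset.sum_insert hi]; exact dec_add (hX i) ih

theorem dec_of (v : V) {X : Matrix (V → Fin d) (V → Fin d) ℂ} (hX : ptraceSite v X = 0) :
    Dec X := by
  refine ⟨fun w => if w = v then X else 0, by simp, fun w => ?_⟩
  by_cases h : w = v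
  · subst h; simpa using hX
  · ext s t; simp [ptraceSite, h]

theorem insertAt_self (v : V) (k : Fin d) (a : {w : V // w ≠ v} → Fin d) :
    insertAt v k a v = k := by simp [insertAt]

theorem ptrace_single_ne (v : V) (s t : V → Fin d) (h : s v ≠ t v) :
    ptraceSite v (Matrix.single s t (1 : ℂ)) = 0 := by
  ext a b
  simp only [ptraceSite, Matrix.of_apply, Matrix.zero_apply]
  refine Finset.sum_eq_zero fun k _ => ?_
  rw [Matrix.single_apply, if_neg]
  rintro ⟨h1, h2⟩
  apply h
  rw [h1, h2, insertAt_self, insertAt_self]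

theorem insertAt_eq_iff (v : V) (k : Fin d) (a : {w : V // w ≠ v} → Fin d) (s : V → Fin d) :
    s = insertAt v k a ↔ s v = k ∧ (fun w : {w : V // w ≠ v} => s w.1) = a := by
  constructor
  · rintro rfl
    refine ⟨insertAt_self _ _ _, ?_⟩
    ext w; simp [insertAt, w.2]
  · rintro ⟨rfl, rfl⟩
    ext w
    by_cases h : w = v
    · subst h; simp [insertAt]
    · simp [insertAt, h]

theorem ptrace_single (v : V) (s : V → Fin d) :
    ptraceSite v (Matrix.single s s (1 : ℂ)) =
      Matrix.single (fun w : {w : V // w ≠ v} => s w.1) (fun w => s w.1) 1 := by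
  ext a b
  simp only [ptraceSite, Matrix.of_apply, Matrix.single_apply, insertAt_eq_iff]
  by_cases h : (fun w : {w : V // w ≠ v} => s w.1) = a ∧ (fun w : {w : V // w ≠ v} => s w.1) = b
  · rw [if_pos h]
    obtain ⟨rfl, rfl⟩ := h
    simp
  · rw [if_neg h]
    refine Finset.sum_eq_zero fun k _ => ?_
    rw [if_neg]
    rintro ⟨h1, h2⟩
    exact h ⟨h1.2, h2.2⟩

theorem dec_diag (B : Finset V) : ∀ s t : V → Fin d, (∀ w, w ∉ B → s w = t w) →
    Dec (Matrix.single s s (1 : ℂ) - Matrix.single t t 1) := by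
  induction B using Finset.induction_on with
  | empty =>
    intro s t h
    have : s = t := funext fun w => h w (by simp)
    subst this
    simpa using dec_zero
  | insert v B hv ih =>
    intro s t h
    have h1 : Dec (Matrix.single s s (1 : ℂ) -
        Matrix.single (Function.update s v (t v)) (Function.update s v (t v)) 1) := by
      apply dec_of v
      rw [ptrace_sub, ptrace_single, ptrace_single, sub_eq_zero]
      have : (fun w : {w : V // w ≠ v} => Function.update s v (t v) w.1) = fun w => s w.1 := by
        ext w; simp [w.2]
      rw [this]
    have h2 := ih (Function.update s v (t v)) t (by
      intro w hw
      by_cases h' : w = v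
      · subst h'; simp
      · simp only [Function.update_of_ne h']
        exact h w (by simp [h', hw]))
    have := dec_add h1 h2
    simpa using this

theorem dec_traceless (X : Matrix (V → Fin d) (V → Fin d) ℂ) (hX : X.trace = 0) : Dec X := by
  have key : X = ∑ s, ∑ t, X s t • (Matrix.single s t (1 : ℂ) -
      if s = t then Matrix.single 0 0 1 else 0) := by
    simp only [smul_sub, Finset.sum_sub_distrib, smul_ite, smul_zero, Finset.sum_ite_eq,
      Finset.mem_univ, if_true, ← Finset.sum_smul]
    have h : ∑ s, X s s = 0 := hX
    rw [h, zero_smul, sub_zero]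
    conv_lhs => rw [matrix_eq_sum_single X]
    simp
  rw [key]
  refine dec_sum _ _ fun s => dec_sum _ _ fun t => dec_smul _ ?_
  by_cases h : s = t
  · subst h
    rw [if_pos rfl]
    exact dec_diag Finset.univ s 0 (by simp)
  · rw [if_neg h, sub_zero]
    obtain ⟨v, hv⟩ := Function.ne_iff.1 h
    exact dec_of v (ptrace_single_ne v s t hv)

end twirl

theorem real_bound {t : ℝ} (ht : 0 ≤ t) : -negMulLog (1 + t) + negMulLog t ≤ log (1 + t) + 1 := by
  rcases eq_or_lt_of_le ht with rfl | ht
  · simp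
  have h : log ((1 + t) / t) ≤ (1 + t) / t - 1 := log_le_sub_one_of_pos (by positivity)
  rw [log_div (by positivity) (by positivity)] at h
  have h2 := mul_le_mul_of_nonneg_left h ht.le
  have h3 : t * ((1 + t) / t - 1) = 1 := by field_simp; ring
  simp only [negMulLog]
  linarith

theorem main_bound {n d : ℕ} (hn : 1 ≤ n) (hd : 2 ≤ d)
    (ρ ω : Matrix (Fin n → Fin d) (Fin n → Fin d) ℂ)
    (hρ : IsState ρ) (hω : IsState ω) (Y : Fin n → Matrix (Fin n → Fin d) (Fin n → Fin d) ℂ)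
    (hY : ρ - ω = ∑ v, Y v) (hY0 : ∀ v, ptraceSite v (Y v) = 0) :
    vnEnt ω - vnEnt ρ - Real.log (n + 1) - 1 ≤
      ((1 / 2) * ∑ v, traceNorm (Y v)) * Real.log (d ^ 2 * n) := by
  have : NeZero d := ⟨by omega⟩
  have : NeZero n := ⟨by omega⟩
  choose P N hP hN hPN htr hnorm using fun v => jordan (Y v) (trace_zero v _ (hY0 v))
  set c : Fin n → ℝ := fun v => (P v).trace.re with hc
  have hc0 : ∀ v, 0 ≤ c v := fun v => (Complex.le_def.1 (hP v).trace_nonneg).1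
  set t := ∑ v, c v with ht
  have ht0 : 0 ≤ t := Finset.sum_nonneg fun v _ => hc0 v
  have ht1 : t ≤ (1 / 2) * ∑ v, traceNorm (Y v) := by
    rw [Finset.mul_sum]; exact Finset.sum_le_sum fun v _ => hnorm v
  have hd0 : (2 : ℝ) ≤ d := by exact_mod_cast hd
  have hn0 : (1 : ℝ) ≤ n := by exact_mod_cast hn
  have hlog : log ((d : ℝ) ^ 2 * n) = 2 * log d + log n := by
    rw [log_mul (by positivity) (by positivity), log_pow]; norm_num
  have hld : 0 ≤ log (d : ℝ) := log_nonneg (by linarith)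
  have hln : 0 ≤ log (n : ℝ) := log_nonneg hn0
  refine le_trans ?_ (mul_le_mul_of_nonneg_right ht1 (by rw [hlog]; positivity))
  rw [hlog]
  have hl1 : 0 ≤ log ((n : ℝ) + 1) := log_nonneg (by linarith)
  by_cases htn : t ≤ n
  swap
  · have h1 := vnEnt_le_log hω
    have h2 := vnEnt_nonneg hρ
    simp only [Fintype.card_fun, Fintype.card_fin, Nat.cast_pow, log_pow] at h1
    push Not at htn
    have h3 : n * log (d : ℝ) ≤ t * log d := mul_le_mul_of_nonneg_right htn.le hld
    have h4 : 0 ≤ t * log n := by positivity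
    have h5 : 0 ≤ t * log d := by positivity
    linarith
  -- Hermitian part of the decomposition
  have hH : ρ - ω = ∑ v, (P v - N v) := by
    simp_rw [hPN]
    rw [← Finset.smul_sum, Finset.sum_add_distrib, ← conjTranspose_sum, ← hY, conjTranspose_sub,
      hρ.1.1.eq, hω.1.1.eq, ← two_smul ℂ, smul_smul]
    norm_num
  have hM : ρ + ∑ v, N v = ω + ∑ v, P v := by
    rw [Finset.sum_sub_distrib] at hH
    rw [← sub_eq_zero] at hH ⊢
    rw [← hH]; abel
  have up : vnEnt (ρ + ∑ v, N v) ≤ vnEnt ρ + ∑ v, vnEnt (N v) := by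
    have := vnEnt_sum_le (fun o : Option (Fin n) => o.elim ρ N) (by
      rintro (_ | v)
      · exact hρ.1
      · exact hN v)
    simpa [Fintype.sum_option] using this
  have lo := F_add hω.1 (posSemidef_sum Finset.univ fun v _ => hP v)
  have lo2 := F_sum Finset.univ P hP
  have hFω : F ω = vnEnt ω := by rw [F, hω.2]; simp
  have hFM : F (ω + ∑ v, P v) = vnEnt (ω + ∑ v, P v) - negMulLog (1 + t) := by
    rw [F, trace_add, trace_sum, hω.2, Complex.add_re, Complex.re_sum]
    simp [ht, hc]
  have site : ∀ v, vnEnt (N v) ≤ F (P v) + 2 * c v * log d + negMulLog (c v) := by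
    intro v
    have := F_le v (hP v) (hN v) (by rw [hPN]; exact ptrace_herm v _ (hY0 v))
    rw [F, ← htr] at this
    linarith
  have site' := Finset.sum_le_sum fun v (_ : v ∈ Finset.univ) => site v
  simp only [Finset.sum_add_distrib, ← Finset.sum_mul, ← Finset.mul_sum] at site'
  have hs := sum_negMulLog_le c hc0
  rw [Fintype.card_fin] at hs
  have hr := real_bound ht0
  have hl2 : log (1 + t) ≤ log ((n : ℝ) + 1) := log_le_log (by linarith) (by linarith)
  rw [hM] at up
  rw [← ht] at site' hs
  linarith

end W1aux


/-- Continuity lower bound for the `W₁` distance: for any two states `ρ, ω` on `n` qudits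
of local dimension `d`, `‖ρ-ω‖_{W₁} ≥ (S(ω) - S(ρ) - ln(n+1) - 1)/ln(d²n)`. -/
theorem W1norm_ge_entropy_diff {n d : ℕ} (hn : 1 ≤ n) (hd : 2 ≤ d)
    (ρ ω : Matrix (Fin n → Fin d) (Fin n → Fin d) ℂ)
    (hρ : IsState ρ) (hω : IsState ω) :
    (vnEnt ω - vnEnt ρ - Real.log (n + 1) - 1) / Real.log (d ^ 2 * n) ≤
      W1norm (ρ - ω) := by
  have hd0 : (2 : ℝ) ≤ d := by exact_mod_cast hd
  have hn0 : (1 : ℝ) ≤ n := by exact_mod_cast hn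
  have hpos : 0 < Real.log ((d : ℝ) ^ 2 * n) := Real.log_pos (by nlinarith)
  have : NeZero d := ⟨by omega⟩
  unfold W1norm
  apply le_csInf
  · obtain ⟨Y, h1, h2⟩ := W1aux.dec_traceless (ρ - ω) (by
      rw [Matrix.trace_sub, hρ.2, hω.2, sub_self])
    exact ⟨_, Y, h1, h2, rfl⟩
  · rintro r ⟨Y, h1, h2, rfl⟩
    rw [div_le_iff₀ hpos]
    exact W1aux.main_bound hn hd ρ ω hρ hω Y h1 h2
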